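/- arXiv:2006.12408 — 3 statements merged into one kernel-verified Lean document; each statement's English description precedes it below -/
import Mathlib

section
/- For any quantum relative entropy 𝐃 (a function on pairs of density matrices of equal finite dimension, nonnegative, satisfying the data-processing inequality under all quantum channels, additivity under tensor products, and the normalization 𝐃(|0⟩⟨0| ∥ ½|0⟩⟨0|+½|1⟩⟨1|) = 1) and all density matrices ρ, σ on ℂ^d: D_min(ρ∥σ) ≤ 𝐃(ρ∥σ) ≤ D_max(ρ∥σ). -/
open scoped ENNReal Kronecker ComplexOrder Matrix
open Classical

/-- A density matrix: positive semidefinite with unit trace. -/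
def IsDensity {n : Type} [Fintype n] (ρ : Matrix n n ℂ) : Prop :=
  ρ.PosSemidef ∧ ρ.trace = 1

/-- The extension `id_m ⊗ Φ` of a map `Φ` on matrices, acting blockwise. -/
def cpExt {a b : Type} (Φ : Matrix a a ℂ → Matrix b b ℂ) (m : Type)
    (M : Matrix (m × a) (m × a) ℂ) : Matrix (m × b) (m × b) ℂ :=
  Matrix.of fun p q => Φ (Matrix.of fun k l => M (p.1, k) (q.1, l)) p.2 q.2

/-- A map on matrices is completely positive if every extension `id_m ⊗ Φ`
preserves positive semidefiniteness. -/
def IsCP {a b : Type} [Fintype a] [Fintype b] (Φ : Matrix a a ℂ → Matrix b b ℂ) : Prop :=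
  ∀ (m : Type) [Fintype m] (M : Matrix (m × a) (m × a) ℂ),
    M.PosSemidef → (cpExt Φ m M).PosSemidef

/-- A quantum channel: a linear, completely positive, trace-preserving map. -/
def IsCPTP {a b : Type} [Fintype a] [Fintype b] (Φ : Matrix a a ℂ → Matrix b b ℂ) : Prop :=
  (∀ (c : ℂ) (A B : Matrix a a ℂ), Φ (c • A + B) = c • Φ A + Φ B) ∧
    IsCP Φ ∧ ∀ A : Matrix a a ℂ, (Φ A).trace = A.trace

/-- The projector onto the support of a Hermitian matrix. -/
noncomputable def suppProj {n : Type} [Fintype n] [DecidableEq n]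
    (ρ : Matrix n n ℂ) : Matrix n n ℂ :=
  if h : ρ.IsHermitian then
    (h.eigenvectorUnitary : Matrix n n ℂ) *
      Matrix.diagonal (fun i => if h.eigenvalues i = 0 then (0 : ℂ) else 1) *
      (h.eigenvectorUnitary : Matrix n n ℂ)ᴴ
  else 0

/-- The min relative entropy `D_min(ρ‖σ) = -log₂ Tr[Π_ρ σ]` (with value `+∞` if
`Tr[Π_ρ σ] = 0`, i.e. if `ρ ⊥ σ`). -/
noncomputable def Dmin {n : Type} [Fintype n] [DecidableEq n]
    (ρ σ : Matrix n n ℂ) : ℝ≥0∞ :=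
  if ((suppProj ρ * σ).trace.re) = 0 then ∞
  else ENNReal.ofReal (- Real.logb 2 ((suppProj ρ * σ).trace.re))

/-- The max relative entropy `D_max(ρ‖σ) = log₂ min {t : tσ ≥ ρ}` (with value `+∞`
if no such `t` exists, i.e. if `supp ρ ⊄ supp σ`). -/
noncomputable def Dmax {n : Type} [Fintype n]
    (ρ σ : Matrix n n ℂ) : ℝ≥0∞ :=
  if ∃ t : ℝ, ((t : ℂ) • σ - ρ).PosSemidef then
    ENNReal.ofReal (Real.logb 2 (sInf {t : ℝ | ((t : ℂ) • σ - ρ).PosSemidef}))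
  else ∞

/-- The channel that measures the effect `E` and prepares `τ` or `τ'` according to the outcome. -/
def measurePrepare {a b : Type} [Fintype a] [DecidableEq a]
    (E : Matrix a a ℂ) (τ τ' : Matrix b b ℂ) (X : Matrix a a ℂ) : Matrix b b ℂ :=
  (E * X).trace • τ + ((1 - E) * X).trace • τ'

lemma isCP_trace_smul {a b : Type} [Fintype a] [Fintype b]
    {E : Matrix a a ℂ} {τ : Matrix b b ℂ} (hE : E.PosSemidef) (hτ : τ.PosSemidef) :
    IsCP fun X => (E * X).trace • τ := by
  intro m _ M hM
  obtain ⟨r, v, rfl⟩ := Matrix.posSemidef_iff_eq_sum_vecMulVec.mp hE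
  let V : Fin r → Matrix m (m × a) ℂ := fun k =>
    Matrix.of fun p x => if p = x.1 then star (v k x.2) else 0
  have key : cpExt (fun X => ((∑ k, Matrix.vecMulVec (v k) (star (v k))) * X).trace • τ) m M =
      (∑ k, V k * M * (V k)ᴴ) ⊗ₖ τ := by
    ext p q
    simp only [cpExt, Matrix.of_apply, Matrix.smul_apply, smul_eq_mul, Matrix.kroneckerMap_apply,
      Matrix.sum_apply, Finset.sum_mul, Matrix.trace_sum]
    refine Finset.sum_congr rfl fun k _ => ?_
    congr 1
    simp only [Matrix.trace, Matrix.diag, Matrix.mul_apply, Matrix.vecMulVec_apply, V,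
      Matrix.of_apply, Matrix.conjTranspose_apply, Fintype.sum_prod_type, Pi.star_apply, apply_ite,
      star_star, star_zero, ite_mul, zero_mul, mul_zero, Finset.sum_mul]
    simp only [Finset.sum_ite_irrel, Finset.sum_const_zero, Finset.sum_ite_eq, Finset.mem_univ,
      if_true]
    refine Finset.sum_congr rfl fun i _ => Finset.sum_congr rfl fun j _ => by ring
  rw [key]
  exact (Matrix.posSemidef_sum _ fun k _ => hM.mul_mul_conjTranspose_same _).kronecker hτ

lemma isCPTP_measurePrepare {a b : Type} [Fintype a] [DecidableEq a] [Fintype b]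
    {E : Matrix a a ℂ} {τ τ' : Matrix b b ℂ} (hE : E.PosSemidef) (hE' : (1 - E).PosSemidef)
    (hτ : IsDensity τ) (hτ' : IsDensity τ') : IsCPTP (measurePrepare E τ τ') := by
  refine ⟨fun c A B => ?_, fun m _ M hM => ?_, fun A => ?_⟩
  · simp only [measurePrepare, Matrix.mul_add, Matrix.mul_smul, Matrix.trace_add,
      Matrix.trace_smul, add_smul, smul_add, smul_eq_mul, mul_smul]
    abel
  · exact (isCP_trace_smul hE hτ.1 m M hM).add (isCP_trace_smul hE' hτ'.1 m M hM)
  · simp [measurePrepare, hτ.2, hτ'.2, sub_mul]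

lemma measurePrepare_of_trace {a b : Type} [Fintype a] [DecidableEq a]
    {E X : Matrix a a ℂ} (τ τ' : Matrix b b ℂ) {q : ℂ} (hX : X.trace = 1)
    (hq : (E * X).trace = q) : measurePrepare E τ τ' X = q • τ + (1 - q) • τ' := by
  simp [measurePrepare, sub_mul, hX, hq]

/-- The density matrix of a biased classical bit. -/
noncomputable def bit (q : ℝ) : Matrix (Fin 2) (Fin 2) ℂ :=
  Matrix.diagonal ![(q : ℂ), 1 - q]

lemma bit_eq (q : ℝ) : bit q = (q : ℂ) • bit 1 + (1 - (q : ℂ)) • bit 0 := by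
  ext i j
  fin_cases i <;> fin_cases j <;> simp [bit]

lemma isDensity_bit {q : ℝ} (h0 : 0 ≤ q) (h1 : q ≤ 1) : IsDensity (bit q) := by
  refine ⟨Matrix.posSemidef_diagonal_iff.mpr fun i => ?_, by simp [bit, Matrix.trace]⟩
  fin_cases i
  · simpa using h0
  · simpa using (by exact_mod_cast h1 : (q : ℂ) ≤ 1)

lemma IsDensity.kronecker {a b : Type} [Fintype a] [Fintype b]
    {ρ : Matrix a a ℂ} {τ : Matrix b b ℂ} (hρ : IsDensity ρ) (hτ : IsDensity τ) :
    IsDensity (ρ ⊗ₖ τ) :=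
  ⟨hρ.1.kronecker hτ.1, by rw [Matrix.trace_kronecker, hρ.2, hτ.2, one_mul]⟩

/-- A density matrix dominating `q • ρ` is a mixture of `ρ` with weight `q` and another one. -/
lemma exists_isDensity_mixture {n : Type} [Fintype n] {ρ σ : Matrix n n ℂ} {q : ℝ}
    (hρ : IsDensity ρ) (hσ : IsDensity σ) (hq : q ≤ 1) (h : (σ - (q : ℂ) • ρ).PosSemidef) :
    ∃ ω, IsDensity ω ∧ σ = (q : ℂ) • ρ + (1 - (q : ℂ)) • ω := by
  have htr : (σ - (q : ℂ) • ρ).trace = 1 - q := by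
    simp [Matrix.trace_sub, hρ.2, hσ.2]
  rcases hq.eq_or_lt with rfl | hq
  · have h0 := h.trace_eq_zero_iff.mp (by simpa using htr)
    exact ⟨ρ, hρ, by simpa [sub_eq_zero] using h0⟩
  · have hne : (1 - (q : ℂ)) ≠ 0 := by
      exact_mod_cast (sub_pos.mpr hq).ne'
    refine ⟨(1 - (q : ℂ))⁻¹ • (σ - (q : ℂ) • ρ), ⟨h.smul ?_, ?_⟩, ?_⟩
    · exact_mod_cast inv_nonneg.mpr (sub_pos.mpr hq).le
    · rw [Matrix.trace_smul, htr, smul_eq_mul, inv_mul_cancel₀ hne]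
    · rw [smul_inv_smul₀ hne]; abel

lemma posSemidef_suppProj {n : Type} [Fintype n] [DecidableEq n] {ρ : Matrix n n ℂ}
    (hρ : ρ.IsHermitian) : (suppProj ρ).PosSemidef := by
  rw [suppProj, dif_pos hρ]
  refine (Matrix.posSemidef_diagonal_iff.mpr fun i => ?_).mul_mul_conjTranspose_same _
  split_ifs <;> simp

lemma posSemidef_one_sub_suppProj {n : Type} [Fintype n] [DecidableEq n] {ρ : Matrix n n ℂ}
    (hρ : ρ.IsHermitian) : (1 - suppProj ρ).PosSemidef := by
  have hU : (hρ.eigenvectorUnitary : Matrix n n ℂ) *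
      (hρ.eigenvectorUnitary : Matrix n n ℂ)ᴴ = 1 :=
    Matrix.mem_unitaryGroup_iff.mp hρ.eigenvectorUnitary.2
  rw [suppProj, dif_pos hρ]
  nth_rewrite 1 [← hU]
  rw [← Matrix.sub_mul]
  nth_rewrite 1 [← Matrix.mul_one (hρ.eigenvectorUnitary : Matrix n n ℂ)]
  rw [← Matrix.mul_sub, ← Matrix.diagonal_one, Matrix.diagonal_sub]
  refine (Matrix.posSemidef_diagonal_iff.mpr fun i => ?_).mul_mul_conjTranspose_same _
  split_ifs <;> simp

lemma suppProj_mul_self {n : Type} [Fintype n] [DecidableEq n] {ρ : Matrix n n ℂ}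
    (hρ : ρ.IsHermitian) : suppProj ρ * ρ = ρ := by
  have hU : (hρ.eigenvectorUnitary : Matrix n n ℂ)ᴴ *
      (hρ.eigenvectorUnitary : Matrix n n ℂ) = 1 :=
    Matrix.mem_unitaryGroup_iff'.mp hρ.eigenvectorUnitary.2
  have hs := hρ.spectral_theorem
  rw [Unitary.conjStarAlgAut_apply, Matrix.star_eq_conjTranspose] at hs
  have key : (hρ.eigenvectorUnitary : Matrix n n ℂ) *
      Matrix.diagonal (fun i => if hρ.eigenvalues i = 0 then (0 : ℂ) else 1) *
      (hρ.eigenvectorUnitary : Matrix n n ℂ)ᴴ * ((hρ.eigenvectorUnitary : Matrix n n ℂ) *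
        Matrix.diagonal (RCLike.ofReal ∘ hρ.eigenvalues) *
        (hρ.eigenvectorUnitary : Matrix n n ℂ)ᴴ) = (hρ.eigenvectorUnitary : Matrix n n ℂ) *
        Matrix.diagonal (RCLike.ofReal ∘ hρ.eigenvalues) *
        (hρ.eigenvectorUnitary : Matrix n n ℂ)ᴴ := by
    simp only [Matrix.mul_assoc]
    rw [← Matrix.mul_assoc _ᴴ, hU, Matrix.one_mul, ← Matrix.mul_assoc (Matrix.diagonal _),
      Matrix.diagonal_mul_diagonal]
    congr 3
    ext i
    by_cases h : hρ.eigenvalues i = 0 <;> simp [h]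
  rw [← hs] at key
  rwa [suppProj, dif_pos hρ]

lemma trace_mul_nonneg_of_posSemidef {n : Type} [Fintype n] {A B : Matrix n n ℂ}
    (hA : A.PosSemidef) (hB : B.PosSemidef) : 0 ≤ (A * B).trace := by
  obtain ⟨r, v, rfl⟩ := Matrix.posSemidef_iff_eq_sum_vecMulVec.mp hA
  rw [Finset.sum_mul, Matrix.trace_sum]
  refine Finset.sum_nonneg fun k _ => ?_
  rw [Matrix.trace_mul_comm, Matrix.mul_vecMulVec, Matrix.trace_vecMulVec, dotProduct_comm]
  exact hB.dotProduct_mulVec_nonneg _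

/-- Antitone additive-over-multiplicative functions on `[0, 1]` are logarithms. -/
lemma eq_neg_logb_of_antitoneOn {f : ℝ → ℝ≥0∞} (hf : AntitoneOn f (Set.Icc 0 1))
    (hmul : ∀ x ∈ Set.Icc (0 : ℝ) 1, ∀ y ∈ Set.Icc (0 : ℝ) 1, f (x * y) = f x + f y)
    (hhalf : f (1 / 2) = 1) {q : ℝ} (h0 : 0 < q) (h1 : q ≤ 1) :
    f q = ENNReal.ofReal (-Real.logb 2 q) := by
  have hmem : (1 / 2 : ℝ) ∈ Set.Icc (0 : ℝ) 1 := by norm_num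
  have hone : f 1 = 0 := by
    have h := hmul (1 / 2) hmem 1 (by norm_num)
    rw [mul_one, hhalf] at h
    exact (ENNReal.add_right_inj ENNReal.one_ne_top).mp (by rw [← h, add_zero])
  have hpow : ∀ x ∈ Set.Icc (0 : ℝ) 1, ∀ n : ℕ, f (x ^ n) = n * f x := by
    intro x hx n
    induction n with
    | zero => simp [hone]
    | succ n ih =>
      rw [pow_succ, hmul _ ⟨pow_nonneg hx.1 n, pow_le_one₀ hx.1 hx.2⟩ _ hx, ih]
      push_cast; ring
  have hhalfpow (k : ℕ) : f ((1 / 2) ^ k) = k := by rw [hpow _ hmem, hhalf, mul_one]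
  have hhalfmem (k : ℕ) : (1 / 2 : ℝ) ^ k ∈ Set.Icc (0 : ℝ) 1 :=
    ⟨by positivity, pow_le_one₀ hmem.1 hmem.2⟩
  have hlog (k : ℕ) : Real.logb 2 ((1 / 2) ^ k) = -k := by
    rw [Real.logb_pow, one_div, Real.logb_inv, Real.logb_self_eq_one one_lt_two]; ring
  have hq : q ∈ Set.Icc (0 : ℝ) 1 := ⟨h0.le, h1⟩
  set l := -Real.logb 2 q with hl
  have hl0 : 0 ≤ l := neg_nonneg.mpr (Real.logb_nonpos one_lt_two h0.le h1)
  have hbound (n : ℕ) : (⌊n * l⌋₊ : ℝ≥0∞) ≤ n * f q ∧ n * f q ≤ (⌊n * l⌋₊ + 1 : ℕ) := by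
    have hqn : q ^ n ∈ Set.Icc (0 : ℝ) 1 := ⟨pow_nonneg h0.le n, pow_le_one₀ h0.le h1⟩
    have hqlog : Real.logb 2 (q ^ n) = -(n * l) := by rw [Real.logb_pow, hl]; ring
    rw [← hpow q hq, ← hhalfpow, ← hhalfpow]
    constructor
    · refine hf hqn (hhalfmem _) ?_
      rw [← Real.logb_le_logb one_lt_two (by positivity) (by positivity), hqlog, hlog]
      exact neg_le_neg (Nat.floor_le (by positivity))
    · refine hf (hhalfmem _) hqn ?_
      rw [← Real.logb_le_logb one_lt_two (by positivity) (by positivity), hqlog, hlog]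
      push_cast
      exact neg_le_neg (Nat.lt_floor_add_one _).le
  have hfin : f q ≠ ∞ := by
    have h := (hbound 1).2
    rw [Nat.cast_one, one_mul] at h
    exact ne_top_of_le_ne_top (ENNReal.natCast_ne_top _) h
  rw [← ENNReal.ofReal_toReal hfin]
  congr 1
  set g := (f q).toReal with hg
  have hreal (n : ℕ) : n * |g - l| ≤ 1 := by
    obtain ⟨ha, hb⟩ := hbound n
    have hmul_fin : n * f q ≠ ∞ := ENNReal.mul_ne_top (ENNReal.natCast_ne_top n) hfin
    rw [← ENNReal.toReal_le_toReal (ENNReal.natCast_ne_top _) hmul_fin] at ha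
    rw [← ENNReal.toReal_le_toReal hmul_fin (ENNReal.natCast_ne_top _)] at hb
    simp only [ENNReal.toReal_natCast, ENNReal.toReal_mul, ← hg] at ha hb
    push_cast at hb
    have := Nat.floor_le (show 0 ≤ n * l by positivity)
    have := Nat.lt_floor_add_one (n * l)
    rw [← Nat.abs_cast n, ← abs_mul, abs_le]
    constructor <;> linarith
  by_contra hne
  obtain ⟨n, hn⟩ := exists_nat_gt (1 / |g - l|)
  rw [div_lt_iff₀ (abs_pos.mpr (sub_ne_zero.mpr hne))] at hn
  exact absurd (hreal n) (not_le.mpr hn)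

/-- **Optimality of the min and max relative entropies.** Any quantum relative entropy
(nonnegative, satisfying data-processing under quantum channels, additivity under tensor
products, and normalization) lies between `D_min` and `D_max`. -/
theorem stmt5
    (D : ∀ (m : Type) [Fintype m] [DecidableEq m],
      Matrix m m ℂ → Matrix m m ℂ → ℝ≥0∞)
    -- data-processing inequality under quantum channels
    (hdpi : ∀ (a b : Type) [Fintype a] [DecidableEq a] [Fintype b] [DecidableEq b]
      (Φ : Matrix a a ℂ → Matrix b b ℂ), IsCPTP Φ →
      ∀ ρ σ : Matrix a a ℂ, IsDensity ρ → IsDensity σ → D b (Φ ρ) (Φ σ) ≤ D a ρ σ)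
    -- additivity under tensor products
    (hadd : ∀ (a b : Type) [Fintype a] [DecidableEq a] [Fintype b] [DecidableEq b]
      (ρ₁ σ₁ : Matrix a a ℂ) (ρ₂ σ₂ : Matrix b b ℂ),
      IsDensity ρ₁ → IsDensity σ₁ → IsDensity ρ₂ → IsDensity σ₂ →
      D (a × b) (ρ₁ ⊗ₖ ρ₂) (σ₁ ⊗ₖ σ₂) = D a ρ₁ σ₁ + D b ρ₂ σ₂)
    -- normalization
    (hnorm : D (Fin 2) (Matrix.diagonal ![1, 0]) (Matrix.diagonal ![1/2, 1/2]) = 1)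
    (d : ℕ) (ρ σ : Matrix (Fin d) (Fin d) ℂ)
    (hρ : IsDensity ρ) (hσ : IsDensity σ) :
    Dmin ρ σ ≤ D (Fin d) ρ σ ∧ D (Fin d) ρ σ ≤ Dmax ρ σ := by
  set f : ℝ → ℝ≥0∞ := fun q => D (Fin 2) (bit 1) (bit q) with hf
  have hb0 : IsDensity (bit 0) := isDensity_bit le_rfl zero_le_one
  have hb1 : IsDensity (bit 1) := isDensity_bit zero_le_one le_rfl
  have lower : ∀ (a : Type) [Fintype a] [DecidableEq a] (E ρ σ : Matrix a a ℂ) (q : ℝ),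
      E.PosSemidef → (1 - E).PosSemidef → IsDensity ρ → IsDensity σ → (E * ρ).trace = 1 →
      (E * σ).trace = q → f q ≤ D a ρ σ := by
    intro a _ _ E ρ σ q hE hE' hρ hσ hEρ hEσ
    have h := hdpi a (Fin 2) _ (isCPTP_measurePrepare hE hE' hb1 hb0) ρ σ hρ hσ
    rw [measurePrepare_of_trace _ _ hρ.2 hEρ, measurePrepare_of_trace _ _ hσ.2 hEσ,
      ← bit_eq q] at h
    simpa using h
  have upper : ∀ (a : Type) [Fintype a] [DecidableEq a] (ρ σ : Matrix a a ℂ) (q : ℝ),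
      IsDensity ρ → IsDensity σ → 0 ≤ q → q ≤ 1 → (σ - (q : ℂ) • ρ).PosSemidef →
      D a ρ σ ≤ f q := by
    intro a _ _ ρ σ q hρ hσ hq0 hq1 h
    obtain ⟨ω, hω, hmix⟩ := exists_isDensity_mixture hρ hσ hq1 h
    have hE' : (1 - bit 1).PosSemidef := by
      convert hb0.1 using 1
      ext i j
      fin_cases i <;> fin_cases j <;> simp [bit]
    have h := hdpi (Fin 2) a _ (isCPTP_measurePrepare hb1.1 hE' hρ hω) (bit 1) (bit q) hb1
      (isDensity_bit hq0 hq1)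
    rw [measurePrepare_of_trace (q := 1) _ _ hb1.2 (by simp [bit]),
      measurePrepare_of_trace (q := (q : ℂ)) _ _ (isDensity_bit hq0 hq1).2 (by simp [bit]),
      ← hmix] at h
    simpa using h
  have hanti : AntitoneOn f (Set.Icc 0 1) := by
    intro x hx y hy hxy
    refine upper _ _ _ _ hb1 (isDensity_bit hy.1 hy.2) hx.1 hx.2 ?_
    have hdiag : bit y - (x : ℂ) • bit 1 =
        Matrix.diagonal ![((y - x : ℝ) : ℂ), ((1 - y : ℝ) : ℂ)] := by
      ext i j
      fin_cases i <;> fin_cases j <;> simp [bit]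
    rw [hdiag, Matrix.posSemidef_diagonal_iff]
    intro i
    fin_cases i
    · exact Complex.zero_le_real.mpr (sub_nonneg.mpr hxy)
    · exact Complex.zero_le_real.mpr (sub_nonneg.mpr hy.2)
  have hmul : ∀ x ∈ Set.Icc (0 : ℝ) 1, ∀ y ∈ Set.Icc (0 : ℝ) 1, f (x * y) = f x + f y := by
    intro x hx y hy
    have hbx := isDensity_bit hx.1 hx.2
    have hby := isDensity_bit hy.1 hy.2
    have hnn (z : ℝ) (hz : z ≤ 1) : 0 ≤ 1 - (z : ℂ) := by
      exact_mod_cast sub_nonneg.mpr hz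
    have hx0 : 0 ≤ (x : ℂ) := Complex.zero_le_real.mpr hx.1
    have hy0 : 0 ≤ (y : ℂ) := Complex.zero_le_real.mpr hy.1
    rw [hf, ← hadd _ _ _ _ _ _ hb1 hbx hb1 hby]
    refine le_antisymm (lower _ (bit 1 ⊗ₖ bit 1) _ _ _ (hb1.kronecker hb1).1 ?_
      (hb1.kronecker hb1) (hbx.kronecker hby) ?_ ?_)
      (upper _ _ _ _ (hb1.kronecker hb1) (hbx.kronecker hby) (mul_nonneg hx.1 hy.1)
        (mul_le_one₀ hx.2 hy.1 hy.2) ?_)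
    · rw [bit, Matrix.diagonal_kronecker_diagonal, ← Matrix.diagonal_one, Matrix.diagonal_sub,
        Matrix.posSemidef_diagonal_iff]
      rintro ⟨i, j⟩
      fin_cases i <;> fin_cases j <;> simp
    · rw [← Matrix.mul_kronecker_mul, Matrix.trace_kronecker]
      simp [bit]
    · rw [← Matrix.mul_kronecker_mul, Matrix.trace_kronecker]
      simp [bit]
    · rw [bit, bit, bit, Matrix.diagonal_kronecker_diagonal, Matrix.diagonal_kronecker_diagonal,
        ← Matrix.diagonal_smul, Matrix.diagonal_sub, Matrix.posSemidef_diagonal_iff]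
      rintro ⟨i, j⟩
      fin_cases i <;> fin_cases j
      · simp
      · simpa using mul_nonneg hx0 (hnn y hy.2)
      · simpa using mul_nonneg (hnn x hx.2) hy0
      · simpa using mul_nonneg (hnn x hx.2) (hnn y hy.2)
  have hhalf : f (1 / 2) = 1 := by
    rw [← hnorm, hf]
    change D _ _ _ = D _ _ _
    congr 1
    · ext i j
      fin_cases i <;> fin_cases j <;> simp [bit]
    · ext i j
      fin_cases i <;> fin_cases j <;> norm_num [bit]
  have hlog {q : ℝ} (h0 : 0 < q) (h1 : q ≤ 1) : f q = ENNReal.ofReal (-Real.logb 2 q) :=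
    eq_neg_logb_of_antitoneOn hanti hmul hhalf h0 h1
  constructor
  · have hP := posSemidef_suppProj hρ.1.1
    have hP' := posSemidef_one_sub_suppProj hρ.1.1
    have hnonneg := trace_mul_nonneg_of_posSemidef hP hσ.1
    have hle := trace_mul_nonneg_of_posSemidef hP' hσ.1
    rw [Matrix.sub_mul, Matrix.one_mul, Matrix.trace_sub, hσ.2] at hle
    have hre : (suppProj ρ * σ).trace = ((suppProj ρ * σ).trace.re : ℂ) :=
      Complex.eq_re_of_ofReal_le hnonneg
    have hre0 : 0 ≤ (suppProj ρ * σ).trace.re := (Complex.le_def.mp hnonneg).1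
    have hre1 : (suppProj ρ * σ).trace.re ≤ 1 := by
      simpa using (Complex.le_def.mp hle).1
    have h := lower _ _ _ _ _ hP hP' hρ hσ (by rw [suppProj_mul_self hρ.1.1, hρ.2]) hre
    refine le_trans ?_ h
    rw [Dmin]
    split_ifs with h0
    · have hzero := hmul 0 (by norm_num) (1 / 2) (by norm_num)
      rw [zero_mul, hhalf] at hzero
      rw [h0]
      by_contra hne
      exact (ENNReal.lt_add_right (fun htop => hne htop.ge) one_ne_zero).ne hzero
    · exact (hlog (hre0.lt_of_ne' h0) hre1).ge
  · rw [Dmax]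
    split_ifs with hex
    swap
    · exact le_top
    set S : Set ℝ := {t : ℝ | ((t : ℂ) • σ - ρ).PosSemidef} with hS
    have hone : ∀ t ∈ S, 1 ≤ t := by
      intro t ht
      have h := (Complex.le_def.mp (Matrix.PosSemidef.trace_nonneg ht)).1
      simpa [Matrix.trace_sub, hρ.2, hσ.2] using h
    have hinf : 1 ≤ sInf S := le_csInf hex hone
    have hbound : ∀ t, sInf S < t → D (Fin d) ρ σ ≤ ENNReal.ofReal (Real.logb 2 t) := by
      intro t ht
      obtain ⟨s, hs, hst⟩ := exists_lt_of_csInf_lt hex ht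
      have ht1 : 1 ≤ t := hinf.trans ht.le
      have ht0 : 0 < t := one_pos.trans_le ht1
      have htS : ((t : ℂ) • σ - ρ).PosSemidef := by
        have h := Matrix.PosSemidef.add hs
          (hσ.1.smul (Complex.zero_le_real.mpr (sub_nonneg.mpr hst.le)))
        convert h using 1
        push_cast
        module
      have hdom : (σ - ((t⁻¹ : ℝ) : ℂ) • ρ).PosSemidef := by
        convert htS.smul (Complex.zero_le_real.mpr (inv_nonneg.mpr ht0.le)) using 1
        rw [smul_sub, smul_smul, ← Complex.ofReal_mul, inv_mul_cancel₀ ht0.ne', Complex.ofReal_one,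
          one_smul]
      refine (upper _ _ _ _ hρ hσ (inv_nonneg.mpr ht0.le) (inv_le_one_of_one_le₀ ht1) hdom).trans ?_
      rw [hlog (inv_pos.mpr ht0) (inv_le_one_of_one_le₀ ht1), Real.logb_inv, neg_neg]
    have hcont : ContinuousAt (fun t => ENNReal.ofReal (Real.logb 2 t)) (sInf S) :=
      ENNReal.continuous_ofReal.continuousAt.comp
        (Real.continuousAt_logb (one_pos.trans_le hinf).ne')
    exact ge_of_tendsto (hcont.tendsto.mono_left nhdsWithin_le_nhds)
      (eventually_nhdsWithin_of_forall (s := Set.Ioi (sInf S)) hbound)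
end

section
/- Let 𝐃₁ be a classical relative entropy and define its maximal quantum extension 𝐃̄₁(ρ∥σ) = inf{𝐃₁(p∥q) : ρ = ∑_x p_x ω_x, σ = ∑_x q_x ω_x for some finite family of density matrices ω_x and probability vectors p, q}. Then for any pure state ψ = |ψ⟩⟨ψ| and any density matrix σ with |ψ⟩ ∈ supp(σ): 𝐃̄₁(ψ∥σ) = D_max(ψ∥σ) = log₂⟨ψ|σ^{−1}|ψ⟩ (with σ^{−1} the pseudoinverse). -/
open scoped ENNReal Kronecker ComplexOrder Matrix
open Classical

/-- A probability vector: nonnegative entries summing to one. -/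
def IsProbVec {n : Type} [Fintype n] (p : n → ℝ) : Prop :=
  (∀ i, 0 ≤ p i) ∧ ∑ i, p i = 1

/-- The (Moore-Penrose) pseudoinverse of a Hermitian matrix. -/
noncomputable def pinv {n : Type} [Fintype n] [DecidableEq n] (σ : Matrix n n ℂ) :
    Matrix n n ℂ :=
  if h : σ.IsHermitian then
    (h.eigenvectorUnitary : Matrix n n ℂ) *
      Matrix.diagonal (fun i => ((h.eigenvalues i : ℂ))⁻¹) *
      (h.eigenvectorUnitary : Matrix n n ℂ)ᴴ
  else 0

/-- The maximal quantum extension of a classical divergence `D₁`: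
`D̄₁(ρ‖σ) = inf { D₁(p‖q) : ρ = ∑ₓ pₓ ωₓ, σ = ∑ₓ qₓ ωₓ }` over all finite families of
density matrices `ωₓ` and probability vectors `p, q`. -/
noncomputable def maxExtQ
    (D1 : ∀ (m : Type) [Fintype m] [DecidableEq m], (m → ℝ) → (m → ℝ) → ℝ≥0∞)
    {d : Type} [Fintype d] (ρ σ : Matrix d d ℂ) : ℝ≥0∞ :=
  sInf { v | ∃ (k : ℕ) (p q : Fin k → ℝ) (ω : Fin k → Matrix d d ℂ),
    IsProbVec p ∧ IsProbVec q ∧ (∀ x, IsDensity (ω x)) ∧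
    ρ = ∑ x, (p x : ℂ) • ω x ∧ σ = ∑ x, (q x : ℂ) • ω x ∧ v = D1 (Fin k) p q }

namespace ClassicalDivergence

/-- The value of a classical divergence on a deterministic bit against a bit of bias `s`. -/
noncomputable def bitDiv
    (D1 : ∀ (m : Type) [Fintype m] [DecidableEq m], (m → ℝ) → (m → ℝ) → ℝ≥0∞) (s : ℝ) : ℝ≥0∞ :=
  D1 (Fin 2) ![1, 0] ![s, 1 - s]

lemma isProbVec_bit {s : ℝ} (h0 : 0 ≤ s) (h1 : s ≤ 1) : IsProbVec ![s, 1 - s] := by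
  constructor
  · intro i
    fin_cases i <;> simp [h0, h1]
  · simp

lemma isProbVec_one_zero : IsProbVec ![(1 : ℝ), 0] := by
  simpa using isProbVec_bit zero_le_one le_rfl

lemma isProbVec_single {a : Type} [Fintype a] [DecidableEq a] (z : a) :
    IsProbVec (Pi.single z (1 : ℝ)) := by
  constructor
  · intro i
    by_cases h : i = z
    · subst h; simp
    · simp [h]
  · simp

variable {D1 : ∀ (m : Type) [Fintype m] [DecidableEq m], (m → ℝ) → (m → ℝ) → ℝ≥0∞}

lemma bitDiv_sum_support_le
    (hdpi : ∀ (a b : Type) [Fintype a] [DecidableEq a] [Fintype b] [DecidableEq b]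
      (S : b → a → ℝ), (∀ y x, 0 ≤ S y x) → (∀ x, ∑ y, S y x = 1) →
      ∀ p q : a → ℝ, IsProbVec p → IsProbVec q →
      D1 b (fun y => ∑ x, S y x * p x) (fun y => ∑ x, S y x * q x) ≤ D1 a p q)
    {a : Type} [Fintype a] [DecidableEq a] {p q : a → ℝ} (hp : IsProbVec p) (hq : IsProbVec q) :
    bitDiv D1 (∑ x, if p x = 0 then 0 else q x) ≤ D1 a p q := by
  have h := hdpi a (Fin 2) (fun y x => if p x = 0 then ![0, 1] y else ![1, 0] y)
    (by intro y x; fin_cases y <;> simp <;> split_ifs <;> simp)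
    (by intro x; split_ifs <;> simp [Fin.sum_univ_two]) p q hp hq
  refine le_trans (le_of_eq ?_) h
  unfold bitDiv
  congr 1
  · funext y
    fin_cases y
    · refine hp.2.symm.trans (Finset.sum_congr rfl fun x _ => ?_)
      by_cases hx : p x = 0 <;> simp [hx]
    · refine (Finset.sum_eq_zero fun x _ => ?_).symm
      by_cases hx : p x = 0 <;> simp [hx]
  · funext y
    fin_cases y
    · refine Finset.sum_congr rfl fun x _ => ?_
      by_cases hx : p x = 0 <;> simp [hx]
    · simp only [Fin.mk_one, Matrix.cons_val_one, Matrix.cons_val_fin_one]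
      conv_lhs => rw [← hq.2, ← Finset.sum_sub_distrib]
      refine Finset.sum_congr rfl fun x _ => ?_
      by_cases hx : p x = 0 <;> simp [hx]

lemma le_bitDiv_apply
    (hdpi : ∀ (a b : Type) [Fintype a] [DecidableEq a] [Fintype b] [DecidableEq b]
      (S : b → a → ℝ), (∀ y x, 0 ≤ S y x) → (∀ x, ∑ y, S y x = 1) →
      ∀ p q : a → ℝ, IsProbVec p → IsProbVec q →
      D1 b (fun y => ∑ x, S y x * p x) (fun y => ∑ x, S y x * q x) ≤ D1 a p q)
    {a : Type} [Fintype a] [DecidableEq a] (z : a) {q r : a → ℝ} {s : ℝ} (h0 : 0 ≤ s) (h1 : s ≤ 1)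
    (hr : IsProbVec r) (hq : ∀ x, q x = s * Pi.single (M := fun _ => ℝ) z 1 x + (1 - s) * r x) :
    D1 a (Pi.single z 1) q ≤ bitDiv D1 s := by
  have h := hdpi (Fin 2) a (fun y x => ![Pi.single (M := fun _ => ℝ) z 1 y, r y] x)
    (by
      intro y x
      fin_cases x
      · exact (isProbVec_single z).1 y
      · exact hr.1 y)
    (by
      intro x
      fin_cases x
      · exact (isProbVec_single z).2
      · exact hr.2) _ _ isProbVec_one_zero (isProbVec_bit h0 h1)
  refine le_trans (le_of_eq ?_) h
  congr 1
  · funext y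
    simp
  · funext y
    rw [hq y]
    simp [mul_comm]

lemma eq_bitDiv_apply
    (hdpi : ∀ (a b : Type) [Fintype a] [DecidableEq a] [Fintype b] [DecidableEq b]
      (S : b → a → ℝ), (∀ y x, 0 ≤ S y x) → (∀ x, ∑ y, S y x = 1) →
      ∀ p q : a → ℝ, IsProbVec p → IsProbVec q →
      D1 b (fun y => ∑ x, S y x * p x) (fun y => ∑ x, S y x * q x) ≤ D1 a p q)
    {a : Type} [Fintype a] [DecidableEq a] (z : a) {q : a → ℝ} (hq : IsProbVec q) :
    D1 a (Pi.single z 1) q = bitDiv D1 (q z) := by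
  have hz0 := hq.1 z
  have hz1 : q z ≤ 1 := hq.2 ▸ Finset.single_le_sum (fun i _ => hq.1 i) (Finset.mem_univ z)
  have hsplit : ∑ x, (q x - q z * Pi.single (M := fun _ => ℝ) z 1 x) = 1 - q z := by
    rw [Finset.sum_sub_distrib, hq.2, ← Finset.mul_sum, (isProbVec_single z).2, mul_one]
  have hnn : ∀ x, 0 ≤ q x - q z * Pi.single (M := fun _ => ℝ) z 1 x := by
    intro x
    by_cases h : x = z
    · subst h; simp
    · simp [h, hq.1 x]
  apply le_antisymm
  · rcases hz1.eq_or_lt with h | h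
    · refine le_bitDiv_apply hdpi z hz0 hz1 (isProbVec_single z) fun x => ?_
      rw [h, sub_self] at hsplit
      have := (Finset.sum_eq_zero_iff_of_nonneg fun i _ => by simpa [h] using hnn i).1 hsplit x
        (Finset.mem_univ x)
      rw [h]
      linarith
    · have hpos : 0 < 1 - q z := by linarith
      refine le_bitDiv_apply hdpi z hz0 hz1
        (r := fun x => (q x - q z * Pi.single (M := fun _ => ℝ) z 1 x) / (1 - q z))
        ⟨fun x => div_nonneg (hnn x) hpos.le, ?_⟩ fun x => ?_
      · rw [← Finset.sum_div, hsplit, div_self hpos.ne']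
      · field_simp
        ring
  · refine le_trans (le_of_eq ?_) (bitDiv_sum_support_le hdpi (isProbVec_single z) hq)
    congr 1
    rw [Finset.sum_eq_single z] <;> simp +contextual

lemma bitDiv_anti
    (hdpi : ∀ (a b : Type) [Fintype a] [DecidableEq a] [Fintype b] [DecidableEq b]
      (S : b → a → ℝ), (∀ y x, 0 ≤ S y x) → (∀ x, ∑ y, S y x = 1) →
      ∀ p q : a → ℝ, IsProbVec p → IsProbVec q →
      D1 b (fun y => ∑ x, S y x * p x) (fun y => ∑ x, S y x * q x) ≤ D1 a p q)
    {s t : ℝ} (h0 : 0 ≤ s) (hst : s ≤ t) (h1 : t ≤ 1) : bitDiv D1 t ≤ bitDiv D1 s := by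
  rcases hst.eq_or_lt with rfl | hlt
  · exact le_rfl
  have hpos : 0 < 1 - s := by linarith
  have key := le_bitDiv_apply hdpi (0 : Fin 2) (q := ![t, 1 - t])
    (r := ![(t - s) / (1 - s), 1 - (t - s) / (1 - s)]) h0 (hst.trans h1)
    (isProbVec_bit (div_nonneg (by linarith) hpos.le) ((div_le_one hpos).2 (by linarith)))
    (by
      intro x
      fin_cases x
      · simp; field_simp; ring
      · simp; field_simp; ring)
  rwa [eq_bitDiv_apply hdpi 0 (isProbVec_bit (h0.trans hst) h1)] at key

lemma bitDiv_mul
    (hdpi : ∀ (a b : Type) [Fintype a] [DecidableEq a] [Fintype b] [DecidableEq b]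
      (S : b → a → ℝ), (∀ y x, 0 ≤ S y x) → (∀ x, ∑ y, S y x = 1) →
      ∀ p q : a → ℝ, IsProbVec p → IsProbVec q →
      D1 b (fun y => ∑ x, S y x * p x) (fun y => ∑ x, S y x * q x) ≤ D1 a p q)
    (hadd : ∀ (a b : Type) [Fintype a] [DecidableEq a] [Fintype b] [DecidableEq b]
      (p₁ q₁ : a → ℝ) (p₂ q₂ : b → ℝ),
      IsProbVec p₁ → IsProbVec q₁ → IsProbVec p₂ → IsProbVec q₂ →
      D1 (a × b) (fun z => p₁ z.1 * p₂ z.2) (fun z => q₁ z.1 * q₂ z.2) =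
        D1 a p₁ q₁ + D1 b p₂ q₂)
    {s t : ℝ} (hs0 : 0 ≤ s) (hs1 : s ≤ 1) (ht0 : 0 ≤ t) (ht1 : t ≤ 1) :
    bitDiv D1 (s * t) = bitDiv D1 s + bitDiv D1 t := by
  have hps := isProbVec_bit hs0 hs1
  have hpt := isProbVec_bit ht0 ht1
  have h := hadd (Fin 2) (Fin 2) _ _ _ _ isProbVec_one_zero hps isProbVec_one_zero hpt
  have hprod : IsProbVec fun z : Fin 2 × Fin 2 => ![s, 1 - s] z.1 * ![t, 1 - t] z.2 := by
    refine ⟨fun z => mul_nonneg (hps.1 _) (hpt.1 _), ?_⟩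
    rw [Fintype.sum_prod_type, ← Finset.sum_mul_sum, hps.2, hpt.2, one_mul]
  have hsingle : (fun z : Fin 2 × Fin 2 => ![(1 : ℝ), 0] z.1 * ![(1 : ℝ), 0] z.2) =
      Pi.single (0, 0) 1 := by
    funext ⟨i, j⟩
    fin_cases i <;> fin_cases j <;> simp
  rw [hsingle, eq_bitDiv_apply hdpi _ hprod] at h
  simpa [bitDiv] using h

/-- A monotone additive function on the nonnegative reals normalized at `1` is the identity. -/
lemma eq_ofReal_of_monotone_of_additive {g : ℝ → ℝ≥0∞}
    (hmono : ∀ x y, 0 ≤ x → x ≤ y → g x ≤ g y)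
    (hadd : ∀ x y, 0 ≤ x → 0 ≤ y → g (x + y) = g x + g y) (hone : g 1 = 1) {x : ℝ} (hx : 0 ≤ x) :
    g x = ENNReal.ofReal x := by
  have hzero : g 0 = 0 := by
    have h := hadd 0 1 le_rfl zero_le_one
    rw [zero_add, hone] at h
    exact (ENNReal.add_left_inj ENNReal.one_ne_top).1 (by rw [← h, zero_add])
  have hsmul : ∀ (n : ℕ) (y : ℝ), 0 ≤ y → g (n * y) = n * g y := by
    intro n y hy
    induction n with
    | zero => simp [hzero]
    | succ k ih =>
      push_cast
      rw [add_mul, one_mul, hadd _ _ (by positivity) hy, ih, add_mul, one_mul]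
  have hnat : ∀ n : ℕ, g n = n := fun n => by simpa [hone] using hsmul n 1 zero_le_one
  have htop : g x ≠ ∞ :=
    ne_top_of_le_ne_top (by rw [hnat]; simp) (hmono x ⌈x⌉₊ hx (Nat.le_ceil x))
  lift g x to NNReal using htop with c hc
  have hupper : ∀ n : ℕ, (n : ℝ) * c ≤ n * x + 1 := by
    intro n
    have hnx : 0 ≤ (n : ℝ) * x := by positivity
    have h := hmono _ _ hnx (Nat.le_ceil _)
    rw [hnat, hsmul n x hx, ← hc] at h
    have h' : (n : ℝ) * c ≤ (⌈(n : ℝ) * x⌉₊ : ℝ) := by exact_mod_cast h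
    exact h'.trans (Nat.ceil_lt_add_one hnx).le
  have hlower : ∀ n : ℕ, (n : ℝ) * x ≤ n * c + 1 := by
    intro n
    have hnx : 0 ≤ (n : ℝ) * x := by positivity
    have h := hmono _ _ (Nat.cast_nonneg _) (Nat.floor_le hnx)
    rw [hnat, hsmul n x hx, ← hc] at h
    have h' : (⌊(n : ℝ) * x⌋₊ : ℝ) ≤ (n : ℝ) * c := by exact_mod_cast h
    linarith [Nat.lt_floor_add_one ((n : ℝ) * x)]
  have hcx : (c : ℝ) = x := by
    apply le_antisymm
    · by_contra! hlt
      obtain ⟨n, hn⟩ := exists_nat_gt (1 / (c - x))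
      rw [div_lt_iff₀ (by linarith)] at hn
      linarith [hupper n]
    · by_contra! hlt
      obtain ⟨n, hn⟩ := exists_nat_gt (1 / (x - c))
      rw [div_lt_iff₀ (by linarith)] at hn
      linarith [hlower n]
  rw [← hcx, ENNReal.ofReal_coe_nnreal]

lemma bitDiv_inv
    (hdpi : ∀ (a b : Type) [Fintype a] [DecidableEq a] [Fintype b] [DecidableEq b]
      (S : b → a → ℝ), (∀ y x, 0 ≤ S y x) → (∀ x, ∑ y, S y x = 1) →
      ∀ p q : a → ℝ, IsProbVec p → IsProbVec q →
      D1 b (fun y => ∑ x, S y x * p x) (fun y => ∑ x, S y x * q x) ≤ D1 a p q)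
    (hadd : ∀ (a b : Type) [Fintype a] [DecidableEq a] [Fintype b] [DecidableEq b]
      (p₁ q₁ : a → ℝ) (p₂ q₂ : b → ℝ),
      IsProbVec p₁ → IsProbVec q₁ → IsProbVec p₂ → IsProbVec q₂ →
      D1 (a × b) (fun z => p₁ z.1 * p₂ z.2) (fun z => q₁ z.1 * q₂ z.2) =
        D1 a p₁ q₁ + D1 b p₂ q₂)
    (hnorm : D1 (Fin 2) ![1, 0] ![1/2, 1/2] = 1) {c : ℝ} (hc : 1 ≤ c) :
    bitDiv D1 c⁻¹ = ENNReal.ofReal (Real.logb 2 c) := by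
  have hle : ∀ x : ℝ, 0 ≤ x → (2 : ℝ) ^ (-x) ≤ 1 := fun x hx =>
    Real.rpow_le_one_of_one_le_of_nonpos one_le_two (by linarith)
  have hnn : ∀ x : ℝ, 0 ≤ (2 : ℝ) ^ (-x) := fun x => by positivity
  have h := eq_ofReal_of_monotone_of_additive (g := fun x => bitDiv D1 ((2 : ℝ) ^ (-x)))
    (fun x y hx hxy => bitDiv_anti hdpi (hnn y)
      (Real.rpow_le_rpow_of_exponent_le one_le_two (by linarith)) (hle x hx))
    (fun x y hx hy => by
      rw [neg_add, Real.rpow_add two_pos]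
      exact bitDiv_mul hdpi hadd (hnn x) (hle x hx) (hnn y) (hle y hy))
    (by
      rw [← hnorm, Real.rpow_neg_one, bitDiv]
      norm_num)
    (Real.logb_nonneg one_lt_two hc)
  rw [← h, Real.rpow_neg two_pos.le, Real.rpow_logb two_pos (by norm_num) (by linarith)]

end ClassicalDivergence

namespace PureState

open Matrix

variable {n : Type} [Fintype n]

lemma nonneg_of_ofReal_mul_nonneg {c : ℝ} (hc : 0 < c) {z : ℂ} (h : 0 ≤ (c : ℂ) * z) : 0 ≤ z := by
  have hc' : (0 : ℂ) ≤ ((c⁻¹ : ℝ) : ℂ) := by exact_mod_cast (inv_pos.2 hc).le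
  have := mul_nonneg hc' h
  rwa [Complex.ofReal_inv, inv_mul_cancel_left₀ (by exact_mod_cast hc.ne')] at this

lemma mul_pinv [DecidableEq n] {σ : Matrix n n ℂ} (hσ : σ.IsHermitian) :
    σ * pinv σ = suppProj σ := by
  have hU : (hσ.eigenvectorUnitary : Matrix n n ℂ)ᴴ * (hσ.eigenvectorUnitary : Matrix n n ℂ) = 1 :=
    Unitary.coe_star_mul_self hσ.eigenvectorUnitary
  have hspec : σ = (hσ.eigenvectorUnitary : Matrix n n ℂ) *
      diagonal (fun i => (hσ.eigenvalues i : ℂ)) * (hσ.eigenvectorUnitary : Matrix n n ℂ)ᴴ := by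
    conv_lhs => rw [hσ.spectral_theorem, Unitary.conjStarAlgAut_apply]
    rfl
  rw [pinv, suppProj, dif_pos hσ, dif_pos hσ]
  generalize (hσ.eigenvectorUnitary : Matrix n n ℂ) = U at *
  generalize hσ.eigenvalues = e at *
  calc σ * (U * diagonal (fun i => ((e i : ℂ))⁻¹) * Uᴴ)
      = U * diagonal (fun i => (e i : ℂ)) * (Uᴴ * U) * diagonal (fun i => ((e i : ℂ))⁻¹) * Uᴴ := by
        rw [hspec]; simp only [Matrix.mul_assoc]
    _ = _ := by
        rw [hU, Matrix.mul_one, Matrix.mul_assoc U, diagonal_mul_diagonal]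
        congr 3
        funext i
        by_cases h : e i = 0 <;> simp [h]

lemma quadForm_proj (v x : n → ℂ) :
    star x ⬝ᵥ vecMulVec v (star v) *ᵥ x = (star x ⬝ᵥ v) * (star v ⬝ᵥ x) := by
  rw [vecMulVec_mulVec, dotProduct_smul]
  simp [mul_comm]

lemma trace_proj {v : n → ℂ} (hv : star v ⬝ᵥ v = 1) : (vecMulVec v (star v)).trace = 1 := by
  rw [trace_vecMulVec, dotProduct_comm, hv]

lemma star_dotProduct_mulVec_of_isHermitian {σ : Matrix n n ℂ} (hσ : σ.IsHermitian)
    (x y : n → ℂ) : star x ⬝ᵥ σ *ᵥ y = star (σ *ᵥ x) ⬝ᵥ y := by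
  rw [star_mulVec, hσ.eq, dotProduct_mulVec]

/-- If `σ w = v` with `⟨v, w⟩ = c > 0`, then `c σ` dominates the projector onto `v`. -/
lemma posSemidef_smul_sub_proj {σ : Matrix n n ℂ} (hσ : σ.PosSemidef) {v w : n → ℂ}
    (hw : σ *ᵥ w = v) {c : ℝ} (hc : 0 < c) (hvw : star v ⬝ᵥ w = c) :
    ((c : ℂ) • σ - vecMulVec v (star v)).PosSemidef := by
  refine .of_dotProduct_mulVec_nonneg ?_ fun x => ?_
  · refine (IsHermitian.smul hσ.1 ?_).sub (posSemidef_vecMulVec_self_star v).1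
    simp [isSelfAdjoint_iff]
  · have h := hσ.dotProduct_mulVec_nonneg ((c : ℂ) • x - (star v ⬝ᵥ x) • w)
    have hwv : star w ⬝ᵥ v = c := by
      rw [← hw, star_dotProduct_mulVec_of_isHermitian hσ.1, hw, hvw]
    have hwx : star w ⬝ᵥ σ *ᵥ x = star v ⬝ᵥ x := by
      rw [star_dotProduct_mulVec_of_isHermitian hσ.1, hw]
    have hxv : star (star v ⬝ᵥ x) = star x ⬝ᵥ v := by
      rw [← star_dotProduct_star, star_star, dotProduct_comm]
    have key : star ((c : ℂ) • x - (star v ⬝ᵥ x) • w) ⬝ᵥ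
        σ *ᵥ ((c : ℂ) • x - (star v ⬝ᵥ x) • w) =
        c * (star x ⬝ᵥ ((c : ℂ) • σ - vecMulVec v (star v)) *ᵥ x) := by
      rw [sub_mulVec, dotProduct_sub, quadForm_proj, smul_mulVec, dotProduct_smul, mulVec_sub,
        mulVec_smul, mulVec_smul, hw, star_sub, star_smul, star_smul, hxv]
      simp only [sub_dotProduct, dotProduct_sub, smul_dotProduct, dotProduct_smul, hwv, hwx,
        smul_eq_mul, RCLike.star_def, Complex.conj_ofReal]
      ring
    rw [key] at h
    exact nonneg_of_ofReal_mul_nonneg hc h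

/-- Testing `a σ ≥ b |v⟩⟨v|` against a preimage `w` of `v` under `σ`. -/
lemma mul_le_of_posSemidef_sub {σ : Matrix n n ℂ} (hσ : σ.IsHermitian) {v w : n → ℂ}
    (hw : σ *ᵥ w = v) {c : ℝ} (hc : 0 < c) (hvw : star v ⬝ᵥ w = c) {a b : ℝ}
    (h : ((a : ℂ) • σ - (b : ℂ) • vecMulVec v (star v)).PosSemidef) : b * c ≤ a := by
  have hwv : star w ⬝ᵥ v = c := by
    rw [← hw, star_dotProduct_mulVec_of_isHermitian hσ, hw, hvw]
  have h' := h.dotProduct_mulVec_nonneg w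
  rw [sub_mulVec, smul_mulVec, smul_mulVec, dotProduct_sub, dotProduct_smul, dotProduct_smul,
    quadForm_proj, hw, hwv, hvw] at h'
  have h'' : 0 ≤ a * c - b * (c * c) := by
    simp only [smul_eq_mul] at h'
    exact_mod_cast h'
  by_contra! hlt
  nlinarith

/-- A density matrix appearing with positive weight in a decomposition of a pure state is that
pure state. -/
lemma eq_proj_of_smul_le {v : n → ℂ} (hv : star v ⬝ᵥ v = 1) {ω : Matrix n n ℂ} (hω : IsDensity ω)
    {p : ℝ} (hp : 0 < p) (hle : (vecMulVec v (star v) - (p : ℂ) • ω).PosSemidef) :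
    ω = vecMulVec v (star v) := by
  have hker : ∀ u, star v ⬝ᵥ u = 0 → ω *ᵥ u = 0 := by
    intro u hu
    rw [← hω.1.dotProduct_mulVec_zero_iff]
    have h := hle.dotProduct_mulVec_nonneg u
    rw [sub_mulVec, dotProduct_sub, quadForm_proj, hu, mul_zero, zero_sub, smul_mulVec,
      dotProduct_smul, smul_eq_mul, ← mul_neg] at h
    exact le_antisymm (neg_nonneg.1 (nonneg_of_ofReal_mul_nonneg hp h))
      (hω.1.dotProduct_mulVec_nonneg u)
  have hfac : ω = vecMulVec (ω *ᵥ v) (star v) := by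
    refine Matrix.ext_of_mulVec_single fun i => ?_
    have h := hker (Pi.single i 1 - (star v ⬝ᵥ Pi.single i 1) • v) (by
      rw [dotProduct_sub, dotProduct_smul, hv]; simp)
    rw [mulVec_sub, mulVec_smul, sub_eq_zero] at h
    rw [h, vecMulVec_mulVec]
    simp
  have htr : star v ⬝ᵥ ω *ᵥ v = 1 := by
    rw [← hω.2]
    conv_rhs => rw [hfac, trace_vecMulVec, dotProduct_comm]
  have hωv : ω *ᵥ v = v := by
    have h1 : ω = vecMulVec v (star (ω *ᵥ v)) := by
      conv_lhs => rw [← hω.1.1.eq, hfac, conjTranspose_vecMulVec, star_star]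
    conv_lhs => rw [h1, vecMulVec_mulVec, ← star_dotProduct_mulVec_of_isHermitian hω.1.1, htr]
    simp
  rw [hfac, hωv]

/-- If `v = ∑ pₓ ωₓ` is pure, then `∑ qₓ ωₓ` dominates `v` with the `q`-weight of the support
of `p`. -/
lemma posSemidef_sum_sub_proj {ι : Type} [Fintype ι] {v : n → ℂ} (hv : star v ⬝ᵥ v = 1)
    {p q : ι → ℝ} {ω : ι → Matrix n n ℂ} (hp : ∀ x, 0 ≤ p x) (hq : ∀ x, 0 ≤ q x)
    (hω : ∀ x, IsDensity (ω x)) (hψ : vecMulVec v (star v) = ∑ x, (p x : ℂ) • ω x) :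
    (∑ x, (q x : ℂ) • ω x -
      ((∑ x, if p x = 0 then 0 else q x : ℝ) : ℂ) • vecMulVec v (star v)).PosSemidef := by
  have hsm : ∀ (r : ℝ) (x : ι), 0 ≤ r → ((r : ℂ) • ω x).PosSemidef := fun r x hr =>
    (hω x).1.smul (by exact_mod_cast hr)
  have hpure : ∀ x, p x ≠ 0 → ω x = vecMulVec v (star v) := by
    intro x hx
    refine eq_proj_of_smul_le hv (hω x) ((hp x).lt_of_ne' hx) ?_
    rw [hψ, ← Finset.sum_erase_add _ _ (Finset.mem_univ x), add_sub_cancel_right]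
    exact posSemidef_sum _ fun y _ => hsm _ y (hp y)
  push_cast
  rw [Finset.sum_smul, ← Finset.sum_sub_distrib]
  refine posSemidef_sum _ fun x _ => ?_
  by_cases hx : p x = 0
  · simpa [hx] using hsm _ x (hq x)
  · simpa [hx, hpure x hx] using PosSemidef.zero

/-- If `c σ` dominates a pure state with `1 ≤ c`, then `σ` is a mixture containing that state with
weight `c⁻¹`. -/
lemma exists_density_decomposition {σ : Matrix n n ℂ} (hσ : IsDensity σ) {v : n → ℂ}
    (hv : star v ⬝ᵥ v = 1) {c : ℝ} (hc : 1 ≤ c)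
    (hdom : ((c : ℂ) • σ - vecMulVec v (star v)).PosSemidef) :
    ∃ ω, IsDensity ω ∧
      σ = ((c⁻¹ : ℝ) : ℂ) • vecMulVec v (star v) + ((1 - c⁻¹ : ℝ) : ℂ) • ω := by
  have htr : ((c : ℂ) • σ - vecMulVec v (star v)).trace = c - 1 := by
    rw [trace_sub, trace_smul, hσ.2, trace_proj hv, smul_eq_mul, mul_one]
  rcases hc.eq_or_lt with rfl | hlt
  · refine ⟨σ, hσ, ?_⟩
    have h := sub_eq_zero.1 (hdom.trace_eq_zero_iff.1 (by rw [htr]; simp))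
    rw [Complex.ofReal_one, one_smul] at h
    simp [h]
  · have hpos : 0 < c - 1 := by linarith
    have hne : (c : ℂ) - 1 ≠ 0 := by exact_mod_cast hpos.ne'
    have hne' : (c : ℂ) ≠ 0 := by exact_mod_cast (by linarith : c ≠ 0)
    refine ⟨((c - 1 : ℝ) : ℂ)⁻¹ • ((c : ℂ) • σ - vecMulVec v (star v)), ⟨hdom.smul ?_, ?_⟩, ?_⟩
    · exact_mod_cast (inv_pos.2 hpos).le
    · rw [trace_smul, htr, smul_eq_mul]
      push_cast
      exact inv_mul_cancel₀ hne
    · have hcoef : ((1 - c⁻¹ : ℝ) : ℂ) * ((c - 1 : ℝ) : ℂ)⁻¹ = (c : ℂ)⁻¹ := by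
        push_cast
        field_simp
      rw [smul_smul, hcoef, smul_sub, smul_smul, inv_mul_cancel₀ hne', one_smul, Complex.ofReal_inv]
      abel

end PureState

/-- **The maximal extension on pure states.** For a classical relative entropy `D₁`,
its maximal quantum extension evaluated at a pure state `ψ = |ψ⟩⟨ψ|` (with `|ψ⟩` in the
support of `σ`) equals `D_max(ψ‖σ) = log₂⟨ψ|σ⁻¹|ψ⟩` (pseudoinverse). -/
theorem stmt11
    (D1 : ∀ (m : Type) [Fintype m] [DecidableEq m], (m → ℝ) → (m → ℝ) → ℝ≥0∞)
    -- data-processing inequality under classical (stochastic) channels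
    (hdpi : ∀ (a b : Type) [Fintype a] [DecidableEq a] [Fintype b] [DecidableEq b]
      (S : b → a → ℝ), (∀ y x, 0 ≤ S y x) → (∀ x, ∑ y, S y x = 1) →
      ∀ p q : a → ℝ, IsProbVec p → IsProbVec q →
      D1 b (fun y => ∑ x, S y x * p x) (fun y => ∑ x, S y x * q x) ≤ D1 a p q)
    -- additivity under tensor products
    (hadd : ∀ (a b : Type) [Fintype a] [DecidableEq a] [Fintype b] [DecidableEq b]
      (p₁ q₁ : a → ℝ) (p₂ q₂ : b → ℝ),
      IsProbVec p₁ → IsProbVec q₁ → IsProbVec p₂ → IsProbVec q₂ →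
      D1 (a × b) (fun z => p₁ z.1 * p₂ z.2) (fun z => q₁ z.1 * q₂ z.2) =
        D1 a p₁ q₁ + D1 b p₂ q₂)
    -- normalization
    (hnorm : D1 (Fin 2) ![1, 0] ![1/2, 1/2] = 1)
    (d : ℕ) (ψv : Fin d → ℂ) (hψ : star ψv ⬝ᵥ ψv = 1)
    (σ : Matrix (Fin d) (Fin d) ℂ) (hσ : IsDensity σ)
    -- `|ψ⟩` lies in the support of `σ`
    (hsupp : (suppProj σ) *ᵥ ψv = ψv) :
    maxExtQ D1 (Matrix.vecMulVec ψv (star ψv)) σ =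
      Dmax (Matrix.vecMulVec ψv (star ψv)) σ ∧
    Dmax (Matrix.vecMulVec ψv (star ψv)) σ =
      ENNReal.ofReal (Real.logb 2 ((star ψv ⬝ᵥ (pinv σ) *ᵥ ψv).re)) := by
  have hσh := hσ.1.1
  obtain ⟨w, hw⟩ : ∃ w, w = pinv σ *ᵥ ψv := ⟨_, rfl⟩
  have hσw : σ *ᵥ w = ψv := by
    rw [hw, Matrix.mulVec_mulVec, PureState.mul_pinv hσh, hsupp]
  have hψw : star ψv ⬝ᵥ w = star w ⬝ᵥ σ *ᵥ w := by
    rw [PureState.star_dotProduct_mulVec_of_isHermitian hσh, hσw]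
  have hnn : 0 ≤ star ψv ⬝ᵥ w := hψw ▸ hσ.1.dotProduct_mulVec_nonneg w
  have hne : star ψv ⬝ᵥ w ≠ 0 := by
    rw [hψw, Ne, hσ.1.dotProduct_mulVec_zero_iff, hσw]
    rintro rfl
    simp at hψ
  rw [← hw]
  obtain ⟨c, hvc⟩ : ∃ c : ℝ, star ψv ⬝ᵥ w = c :=
    ⟨_, Complex.eq_re_of_ofReal_le (r := 0) (by simpa using hnn)⟩
  have hc : 0 < c := by
    rw [hvc] at hnn hne
    exact lt_of_le_of_ne (by exact_mod_cast hnn) (by exact_mod_cast hne.symm)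
  have hdom := PureState.posSemidef_smul_sub_proj hσ.1 hσw hc hvc
  have hc1 : 1 ≤ c := by
    have h := hdom.trace_nonneg
    rw [Matrix.trace_sub, Matrix.trace_smul, hσ.2, PureState.trace_proj hψ, smul_eq_mul,
      mul_one] at h
    have : 0 ≤ c - 1 := by exact_mod_cast h
    linarith
  have hDmax : Dmax (Matrix.vecMulVec ψv (star ψv)) σ = ENNReal.ofReal (Real.logb 2 c) := by
    have hleast : IsLeast {t : ℝ | ((t : ℂ) • σ - Matrix.vecMulVec ψv (star ψv)).PosSemidef} c := by
      refine ⟨hdom, fun t ht => ?_⟩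
      simpa using PureState.mul_le_of_posSemidef_sub hσh hσw hc hvc (a := t) (b := 1)
        (by simpa using ht)
    rw [Dmax, if_pos ⟨c, hdom⟩, hleast.csInf_eq]
  rw [hvc, Complex.ofReal_re]
  refine ⟨?_, hDmax⟩
  rw [hDmax, ← ClassicalDivergence.bitDiv_inv hdpi hadd hnorm hc1]
  have hs0 : 0 ≤ c⁻¹ := inv_nonneg.2 hc.le
  have hs1 : c⁻¹ ≤ 1 := inv_le_one_of_one_le₀ hc1
  apply le_antisymm
  · obtain ⟨ω, hω, hdecomp⟩ := PureState.exists_density_decomposition hσ hψ hc1 hdom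
    refine sInf_le ⟨2, ![1, 0], ![c⁻¹, 1 - c⁻¹], ![Matrix.vecMulVec ψv (star ψv), ω],
      ClassicalDivergence.isProbVec_one_zero, ClassicalDivergence.isProbVec_bit hs0 hs1, ?_, ?_,
      ?_, ?_⟩
    · intro x
      fin_cases x
      · exact ⟨Matrix.posSemidef_vecMulVec_self_star ψv, PureState.trace_proj hψ⟩
      · exact hω
    · simp
    · rw [Fin.sum_univ_two]
      exact hdecomp
    · unfold ClassicalDivergence.bitDiv
      congr
  · refine le_sInf ?_
    rintro _ ⟨k, p, q, ω, hp, hq, hω, hψω, hσω, rfl⟩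
    have hdomq := PureState.posSemidef_sum_sub_proj (q := q) hψ hp.1 hq.1 hω hψω
    rw [← hσω] at hdomq
    have hle := PureState.mul_le_of_posSemidef_sub hσh hσw hc hvc (a := 1)
      (by simpa only [Complex.ofReal_one, one_smul] using hdomq)
    refine (ClassicalDivergence.bitDiv_anti hdpi ?_ ?_ hs1).trans
      (le_of_le_of_eq (ClassicalDivergence.bitDiv_sum_support_le hdpi hp hq) ?_)
    · exact Finset.sum_nonneg fun x _ => by split_ifs <;> simp [hq.1 x]
    · rwa [inv_eq_one_div, le_div_iff₀ hc]
    · congr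
end

section
/- The maximal LOCC extension of the pure-state Schmidt rank N(ψ^{AB}) = rank(Tr_B ψ^{AB}) to mixed bipartite states equals the Schmidt number of Terhal–Horodecki: for every density matrix ρ on A⊗B, inf{N(ψ) : ψ pure bipartite, ρ = ℰ(ψ) for some LOCC channel ℰ} = min{k : ρ admits a pure-state decomposition ρ = ∑_i p_i |ψ_i⟩⟨ψ_i| with every ψ_i of Schmidt rank ≤ k}. -/
open scoped ENNReal Kronecker ComplexOrder Matrix
open Classical

/-- The Schmidt rank of a bipartite pure state vector `v : A × B → ℂ`:
the rank of the associated coefficient matrix (equivalently, of the reduced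
density matrix `Tr_B |v⟩⟨v|`). -/
noncomputable def schmidtRank {A B : Type} [Fintype A] [Fintype B]
    (v : A × B → ℂ) : ℕ :=
  (Matrix.of fun a b => v (a, b)).rank

lemma Nat.sInf_le_sInf_of_forall_exists_le {S T : Set ℕ} (hST : ∀ k ∈ S, ∃ l ∈ T, l ≤ k)
    (hTS : ∀ k ∈ T, ∃ l ∈ S, l ≤ k) : sInf T ≤ sInf S := by
  rcases S.eq_empty_or_nonempty with rfl | hS
  · have hT : T = ∅ := Set.eq_empty_of_forall_notMem fun k hk => by simpa using hTS k hk
    rw [hT]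
  · obtain ⟨l, hl, hlk⟩ := hST _ (Nat.sInf_mem hS)
    exact (Nat.sInf_le hl).trans hlk

/-- Two sets of natural numbers, each minorizing the other, have the same infimum. -/
lemma Nat.sInf_eq_sInf_of_forall_exists_le {S T : Set ℕ} (hST : ∀ k ∈ S, ∃ l ∈ T, l ≤ k)
    (hTS : ∀ k ∈ T, ∃ l ∈ S, l ≤ k) : sInf S = sInf T :=
  le_antisymm (Nat.sInf_le_sInf_of_forall_exists_le hTS hST)
    (Nat.sInf_le_sInf_of_forall_exists_le hST hTS)

/-- Any two injections of the same type into equinumerous finite types differ by a bijection. -/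
lemma exists_equiv_comp_eq {κ α β : Type*} [Fintype α] [Fintype β]
    (hcard : Fintype.card α = Fintype.card β) {ι : κ → α} {τ : κ → β}
    (hι : Function.Injective ι) (hτ : Function.Injective τ) :
    ∃ e : α ≃ β, ∀ c, e (ι c) = τ c := by
  let f : α ≃ β := Fintype.equivOfCardEq hcard
  let g : {x // x ∈ Set.range (f ∘ ι)} ≃ {x // x ∈ Set.range τ} :=
    (Equiv.ofInjective _ (f.injective.comp hι)).symm.trans (Equiv.ofInjective _ hτ)
  refine ⟨f.trans g.extendSubtype, fun c => ?_⟩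
  rw [Equiv.trans_apply, g.extendSubtype_apply_of_mem (f (ι c)) ⟨c, rfl⟩]
  have h : (⟨f (ι c), ⟨c, rfl⟩⟩ : {x // x ∈ Set.range (f ∘ ι)}) =
      Equiv.ofInjective _ (f.injective.comp hι) c := rfl
  rw [h, Equiv.trans_apply, Equiv.symm_apply_apply, Equiv.ofInjective_apply]

/-- A finite set of at most `k` elements is covered by an injection from `Fin k`. -/
lemma exists_injective_fin_covering {β : Type*} [Fintype β] {k : ℕ} (s : Finset β)
    (hs : s.card ≤ k) (hk : k ≤ Fintype.card β) :
    ∃ τ : Fin k → β, Function.Injective τ ∧ ∀ x ∈ s, x ∈ Set.range τ := by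
  obtain ⟨t, hst, rfl⟩ := Finset.exists_superset_card_eq hs hk
  refine ⟨fun i => t.equivFin.symm i, Subtype.val_injective.comp t.equivFin.symm.injective,
    fun x hx => ⟨t.equivFin ⟨x, hst hx⟩, by simp⟩⟩

/-- Singular value decomposition of a matrix of rank at most `k`: in a suitable orthonormal basis
of the domain, the matrix has at most `k` nonzero columns, and these are pairwise orthogonal. -/
lemma exists_unitary_orthogonal_columns {A B : Type} [Fintype A] [Fintype B] [DecidableEq B]
    {k : ℕ} (W : Matrix A B ℂ) (hW : W.rank ≤ k) (hk : k ≤ Fintype.card B) :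
    ∃ (V : Matrix B B ℂ) (τ : Fin k → B) (d : Fin k → ℂ),
      Vᴴ * V = 1 ∧ V * Vᴴ = 1 ∧ Function.Injective τ ∧
      ((W * V).submatrix id τ)ᴴ * (W * V).submatrix id τ = Matrix.diagonal d ∧
      ∑ c, d c = (Wᴴ * W).trace ∧
      (W * V).submatrix id τ * (V.submatrix id τ)ᴴ = W := by
  have hH : (Wᴴ * W).IsHermitian := Matrix.isHermitian_conjTranspose_mul_self W
  set V : Matrix B B ℂ := (hH.eigenvectorUnitary : Matrix B B ℂ) with hV
  have hVV : Vᴴ * V = 1 := Unitary.coe_star_mul_self hH.eigenvectorUnitary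
  have hVV' : V * Vᴴ = 1 := Unitary.coe_mul_star_self hH.eigenvectorUnitary
  have hdiag : (W * V)ᴴ * (W * V) = Matrix.diagonal fun x => (hH.eigenvalues x : ℂ) := by
    have h := hH.conjStarAlgAut_star_eigenvectorUnitary
    rw [Unitary.conjStarAlgAut_star_apply] at h
    rw [Matrix.conjTranspose_mul, Matrix.mul_assoc, ← Matrix.mul_assoc Wᴴ, ← Matrix.mul_assoc]
    exact h
  obtain ⟨τ, hτ, hcov⟩ := exists_injective_fin_covering
    (Finset.univ.filter fun x => hH.eigenvalues x ≠ 0)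
    (by
      rw [← Fintype.card_subtype, ← hH.rank_eq_card_non_zero_eigs,
        Matrix.rank_conjTranspose_mul_self]
      exact hW) hk
  have hzero : ∀ x ∉ Set.range τ, hH.eigenvalues x = 0 := by
    intro x hx
    by_contra h
    exact hx (hcov x (by simpa using h))
  have hcol : ∀ x ∉ Set.range τ, ∀ a, (W * V) a x = 0 := by
    intro x hx a
    have h : star (fun a => (W * V) a x) ⬝ᵥ (fun a => (W * V) a x) = 0 := by
      have := congrFun (congrFun hdiag x) x
      rw [Matrix.diagonal_apply_eq, hzero x hx, Complex.ofReal_zero] at this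
      exact this
    exact congrFun (dotProduct_star_self_eq_zero.mp (by rwa [dotProduct_comm] at h)) a
  refine ⟨V, τ, fun c => hH.eigenvalues (τ c), hVV, hVV', hτ, ?_, ?_, ?_⟩
  · ext c c'
    have h := congrFun (congrFun hdiag (τ c)) (τ c')
    rw [Matrix.diagonal_apply] at h ⊢
    simp only [hτ.eq_iff] at h
    exact h
  · have htr : (Wᴴ * W).trace = ((W * V)ᴴ * (W * V)).trace := by
      rw [Matrix.trace_mul_comm (W * V)ᴴ, Matrix.conjTranspose_mul, Matrix.mul_assoc,
        ← Matrix.mul_assoc V, hVV', Matrix.one_mul, Matrix.trace_mul_comm]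
    rw [htr, hdiag, Matrix.trace_diagonal]
    exact Fintype.sum_of_injective τ hτ _ _ (fun x hx => by simp [hzero x hx]) fun _ => rfl
  · have hWV : W * V * Vᴴ = W := by rw [Matrix.mul_assoc, hVV', Matrix.mul_one]
    ext a y
    rw [← congrFun (congrFun hWV a) y]
    simp only [Matrix.mul_apply (M := W * V), Matrix.mul_apply (M := (W * V).submatrix id τ)]
    exact Fintype.sum_of_injective τ hτ _ _ (fun x hx => by rw [hcol x hx, zero_mul])
      fun _ => rfl

lemma Matrix.eq_zero_of_rank_eq_zero {A B : Type*} [Fintype A] [Fintype B]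
    {W : Matrix A B ℂ} (hW : W.rank = 0) : W = 0 := by
  have h : W.mulVecLin = 0 := LinearMap.range_eq_bot.mp (Submodule.finrank_eq_zero.mp hW)
  refine Matrix.ext_of_mulVec_single fun i => ?_
  rw [Matrix.zero_mulVec]
  exact LinearMap.congr_fun h (Pi.single i 1)

/-- The coefficient matrix of `(K ⊗ U) v` is `K * X * Uᵀ`, with `X` the coefficient matrix
of `v`. -/
lemma of_kronecker_mulVec {A B α β : Type} [Fintype α] [Fintype β]
    (K : Matrix A α ℂ) (U : Matrix B β ℂ) (v : α × β → ℂ) :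
    (Matrix.of fun a b => ((K ⊗ₖ U) *ᵥ v) (a, b)) =
      K * (Matrix.of fun a b => v (a, b)) * Uᵀ := by
  ext a b
  simp only [Matrix.of_apply, Matrix.mulVec, dotProduct, Matrix.kroneckerMap_apply,
    Fintype.sum_prod_type, Matrix.mul_apply, Matrix.transpose_apply, Finset.sum_mul]
  rw [Finset.sum_comm]
  exact Finset.sum_congr rfl fun _ _ => Finset.sum_congr rfl fun _ _ => by ring

lemma schmidtRank_kronecker_mulVec_le {A B α β : Type} [Fintype A] [Fintype B] [Fintype α]
    [Fintype β] (K : Matrix A α ℂ) (U : Matrix B β ℂ) (v : α × β → ℂ) :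
    schmidtRank ((K ⊗ₖ U) *ᵥ v) ≤ schmidtRank v := by
  unfold schmidtRank
  rw [of_kronecker_mulVec]
  exact (Matrix.rank_mul_le_left _ _).trans (Matrix.rank_mul_le_right _ _)

lemma schmidtRank_smul_le {A B : Type} [Fintype A] [Fintype B] (c : ℂ) (v : A × B → ℂ) :
    schmidtRank (c • v) ≤ schmidtRank v := by
  have h : (Matrix.of fun a b => (c • v) (a, b)) =
      (c • (1 : Matrix A A ℂ)) * Matrix.of fun a b => v (a, b) := by
    rw [Matrix.smul_mul, Matrix.one_mul]
    rfl
  unfold schmidtRank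
  rw [h]
  exact Matrix.rank_mul_le_right _ _

lemma mul_vecMulVec_star_mul_conjTranspose {m n : Type*} [Fintype n]
    (M : Matrix m n ℂ) (v : n → ℂ) :
    M * Matrix.vecMulVec v (star v) * Mᴴ = Matrix.vecMulVec (M *ᵥ v) (star (M *ᵥ v)) := by
  rw [Matrix.mul_vecMulVec, Matrix.vecMulVec_mul, Matrix.star_mulVec]

lemma vecMulVec_smul_star {n : Type*} (c : ℂ) (v : n → ℂ) :
    Matrix.vecMulVec (c • v) (star (c • v)) =
      (c * star c) • Matrix.vecMulVec v (star v) := by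
  ext i j
  simp only [Matrix.vecMulVec_apply, Matrix.smul_apply, Pi.smul_apply, Pi.star_apply,
    smul_eq_mul, star_mul']
  ring

/-- A nonzero vector is a positive multiple of a unit vector, which is itself a multiple of it. -/
lemma exists_unit_vector {n : Type*} [Fintype n] (v : n → ℂ) (hv : v ≠ 0) :
    ∃ (p : ℝ) (c : ℂ), 0 ≤ p ∧ star (c • v) ⬝ᵥ (c • v) = 1 ∧
      Matrix.vecMulVec v (star v) =
        (p : ℂ) • Matrix.vecMulVec (c • v) (star (c • v)) := by
  have hpos : 0 < star v ⬝ᵥ v := Matrix.dotProduct_star_self_pos_iff.mpr hv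
  obtain ⟨hre, him⟩ := Complex.pos_iff.mp hpos
  set r := (star v ⬝ᵥ v).re with hr
  have hvr : star v ⬝ᵥ v = (r : ℂ) := Complex.ext rfl (by simpa using him.symm)
  have hs : ((Real.sqrt r)⁻¹ : ℝ) * ((Real.sqrt r)⁻¹ : ℝ) = r⁻¹ := by
    rw [← mul_inv, Real.mul_self_sqrt hre.le]
  have hc : (((Real.sqrt r)⁻¹ : ℝ) : ℂ) * star (((Real.sqrt r)⁻¹ : ℝ) : ℂ) = (r : ℂ)⁻¹ := by
    rw [Complex.star_def, Complex.conj_ofReal, ← Complex.ofReal_mul, hs, Complex.ofReal_inv]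
  have hr0 : (r : ℂ) ≠ 0 := by exact_mod_cast hre.ne'
  refine ⟨r, ((Real.sqrt r)⁻¹ : ℝ), hre.le, ?_, ?_⟩
  · rw [star_smul, smul_dotProduct, dotProduct_smul, hvr, smul_eq_mul, smul_eq_mul, ← mul_assoc,
      mul_comm (star _), hc, inv_mul_cancel₀ hr0]
  · rw [vecMulVec_smul_star, hc, smul_smul, mul_inv_cancel₀ hr0, one_smul]

/-- A nonzero sum of rank-one operators `|v j⟩⟨v j|` with Schmidt ranks at most `k` is a
nonnegative combination of projectors onto unit vectors of Schmidt rank at most `k`. -/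
lemma exists_decomposition_of_sum_vecMulVec {A B : Type} [Fintype A] [Fintype B] {J k : ℕ}
    (v : Fin J → A × B → ℂ) (hv : ∀ j, schmidtRank (v j) ≤ k) (hne : ∃ j, v j ≠ 0) :
    ∃ (p : Fin J → ℝ) (w : Fin J → (A × B → ℂ)),
      (∀ i, 0 ≤ p i) ∧ (∀ i, star (w i) ⬝ᵥ w i = 1) ∧
      ∑ j, Matrix.vecMulVec (v j) (star (v j)) =
        ∑ i, (p i : ℂ) • Matrix.vecMulVec (w i) (star (w i)) ∧
      ∀ i, schmidtRank (w i) ≤ k := by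
  obtain ⟨j₀, hj₀⟩ := hne
  obtain ⟨-, c₀, -, hunit, -⟩ := exists_unit_vector (v j₀) hj₀
  have key : ∀ j, ∃ (p : ℝ) (w : A × B → ℂ), 0 ≤ p ∧ star w ⬝ᵥ w = 1 ∧
      Matrix.vecMulVec (v j) (star (v j)) = (p : ℂ) • Matrix.vecMulVec w (star w) ∧
      schmidtRank w ≤ k := by
    intro j
    by_cases hj : v j = 0
    · exact ⟨0, c₀ • v j₀, le_rfl, hunit, by simp [hj],
        (schmidtRank_smul_le _ _).trans (hv j₀)⟩
    · obtain ⟨p, c, hp, hc, heq⟩ := exists_unit_vector (v j) hj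
      exact ⟨p, c • v j, hp, hc, heq, (schmidtRank_smul_le _ _).trans (hv j)⟩
  choose p w hp hw heq hrank using key
  exact ⟨p, w, hp, hw, Finset.sum_congr rfl fun j _ => heq j, hrank⟩

/-- The maximally entangled state on `Fin k × β` supported on the image of `ι`. -/
noncomputable def maxEntangled {β : Type*} {k : ℕ} (ι : Fin k → β) : Fin k × β → ℂ :=
  fun x => if x.2 = ι x.1 then (((Real.sqrt k)⁻¹ : ℝ) : ℂ) else 0

lemma inv_sqrt_mul_self (k : ℕ) :
    (((Real.sqrt k)⁻¹ : ℝ) : ℂ) * (((Real.sqrt k)⁻¹ : ℝ) : ℂ) = (k : ℂ)⁻¹ := by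
  rw [← Complex.ofReal_mul, ← mul_inv, Real.mul_self_sqrt k.cast_nonneg]
  simp

lemma star_maxEntangled_dotProduct {β : Type*} [Fintype β] {k : ℕ} [NeZero k] (ι : Fin k → β) :
    star (maxEntangled ι) ⬝ᵥ maxEntangled ι = 1 := by
  have hk : (k : ℂ) ≠ 0 := Nat.cast_ne_zero.mpr (NeZero.ne k)
  simp only [dotProduct, Fintype.sum_prod_type, maxEntangled, Pi.star_apply, mul_ite, mul_zero,
    Finset.sum_ite_eq', Finset.mem_univ, if_true, Complex.star_def, Complex.conj_ofReal,
    inv_sqrt_mul_self, Finset.sum_const, Finset.card_univ, Fintype.card_fin, nsmul_eq_mul]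
  exact mul_inv_cancel₀ hk

lemma schmidtRank_maxEntangled_le {β : Type} [Fintype β] {k : ℕ} (ι : Fin k → β) :
    schmidtRank (maxEntangled ι) ≤ k :=
  (Matrix.rank_le_card_height _).trans_eq (Fintype.card_fin k)

/-- Applying `K ⊗ U` to the maximally entangled state. -/
lemma kronecker_mulVec_maxEntangled {A B β : Type} [Fintype β] {k : ℕ} (ι : Fin k → β)
    (K : Matrix A (Fin k) ℂ) (U : Matrix B β ℂ) (x : A × B) :
    ((K ⊗ₖ U) *ᵥ maxEntangled ι) x =
      (((Real.sqrt k)⁻¹ : ℝ) : ℂ) * (K * (U.submatrix id ι)ᵀ) x.1 x.2 := by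
  simp only [Matrix.mulVec, dotProduct, Fintype.sum_prod_type, maxEntangled, mul_ite, mul_zero,
    Finset.sum_ite_eq', Finset.mem_univ, if_true, Matrix.kroneckerMap_apply, Matrix.mul_apply,
    Matrix.transpose_apply, Matrix.submatrix_apply, id, Finset.mul_sum]
  exact Finset.sum_congr rfl fun _ _ => by ring

/-- A unit vector of Schmidt rank at most `k` is obtained from the maximally entangled state of
Schmidt rank `k` by a channel with `k` Kraus operators `K s ⊗ U s`, each producing the vector with
equal probability. -/
lemma exists_kraus_of_schmidtRank_le {A B β : Type} [Fintype A] [Fintype B] [DecidableEq B]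
    [Fintype β] [DecidableEq β] {k : ℕ} [NeZero k] (hcard : Fintype.card β = Fintype.card B)
    (hk : k ≤ Fintype.card B) {ι : Fin k → β} (hι : Function.Injective ι)
    (w : A × B → ℂ) (hw : star w ⬝ᵥ w = 1) (hrank : schmidtRank w ≤ k) :
    ∃ (K : Fin k → Matrix A (Fin k) ℂ) (U : Fin k → Matrix B β ℂ),
      (∀ s, (U s)ᴴ * U s = 1 ∧ U s * (U s)ᴴ = 1) ∧
      ∑ s, (K s)ᴴ * K s = 1 ∧
      ∀ s, (K s ⊗ₖ U s) *ᵥ maxEntangled ι = (((Real.sqrt k)⁻¹ : ℝ) : ℂ) • w := by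
  set W : Matrix A B ℂ := Matrix.of fun a b => w (a, b) with hWdef
  obtain ⟨V, τ, d, hVV, hVV', hτ, hdiag, hsum, hfac⟩ :=
    exists_unitary_orthogonal_columns W hrank hk
  have htr : (Wᴴ * W).trace = 1 := by
    rw [← hw]
    simp only [Matrix.trace, Matrix.diag_apply, Matrix.mul_apply, Matrix.conjTranspose_apply,
      dotProduct, Fintype.sum_prod_type, Pi.star_apply, hWdef, Matrix.of_apply]
    exact Finset.sum_comm
  set L := (W * V).submatrix id τ with hL
  have hbij : ∀ s : Fin k, ∃ e : β ≃ B, ∀ c, e (ι c) = τ (c + s) := fun s =>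
    exists_equiv_comp_eq hcard hι (hτ.comp (add_left_injective s))
  choose e he using hbij
  refine ⟨fun s => L.submatrix id (Equiv.addRight s), fun s => Vᴴᵀ.submatrix id (e s),
    fun s => ⟨?_, ?_⟩, ?_, fun s => ?_⟩
  · have h : (Vᴴᵀ)ᴴ * Vᴴᵀ = 1 := by
      rw [show (Vᴴᵀ)ᴴ = Vᵀ by ext; simp, ← Matrix.transpose_mul, hVV, Matrix.transpose_one]
    rw [Matrix.conjTranspose_submatrix,
      ← Matrix.submatrix_mul _ _ _ id _ Function.bijective_id, h, Matrix.submatrix_one_equiv]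
  · have h : Vᴴᵀ * (Vᴴᵀ)ᴴ = 1 := by
      rw [show (Vᴴᵀ)ᴴ = Vᵀ by ext; simp, ← Matrix.transpose_mul, hVV', Matrix.transpose_one]
    rw [Matrix.conjTranspose_submatrix, Matrix.submatrix_mul_equiv, h, Matrix.submatrix_id_id]
  · have h : ∀ s : Fin k, (L.submatrix id (Equiv.addRight s))ᴴ * L.submatrix id (Equiv.addRight s)
        = Matrix.diagonal fun c => d (c + s) := by
      intro s
      rw [Matrix.conjTranspose_submatrix,
        ← Matrix.submatrix_mul _ _ _ id _ Function.bijective_id, hdiag,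
        Matrix.submatrix_diagonal_equiv]
      rfl
    simp only [h]
    ext c c'
    rw [Matrix.sum_apply]
    simp only [Matrix.diagonal_apply, Matrix.one_apply]
    split_ifs
    · rw [← htr, ← hsum]
      exact Equiv.sum_comp (Equiv.addLeft c) d
    · simp
  · have h : L.submatrix id (Equiv.addRight s) * ((Vᴴᵀ.submatrix id (e s)).submatrix id ι)ᵀ
        = W := by
      have hU : ((Vᴴᵀ.submatrix id (e s)).submatrix id ι)ᵀ =
          (V.submatrix id τ)ᴴ.submatrix (Equiv.addRight s) id := by
        ext c y
        simp [he]
      rw [hU, Matrix.submatrix_mul_equiv, hfac, Matrix.submatrix_id_id]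
    ext x
    rw [kronecker_mulVec_maxEntangled, h]
    rfl

/-- If `ρ` is a convex combination of unit vectors of Schmidt rank at most `k`, with
`k ≤ card B`, then `ρ` is the image of a maximally entangled state under an LOCC channel. -/
lemma exists_locc_of_decomposition {A B β : Type} [Fintype A] [Fintype B] [DecidableEq B]
    [Fintype β] [DecidableEq β] {k m : ℕ} [NeZero k] (hcard : Fintype.card β = Fintype.card B)
    (hk : k ≤ Fintype.card B) {ι : Fin k → β} (hι : Function.Injective ι)
    (p : Fin m → ℝ) (w : Fin m → A × B → ℂ) (hp : ∀ i, 0 ≤ p i) (hsum : ∑ i, p i = 1)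
    (hw : ∀ i, star (w i) ⬝ᵥ w i = 1) (hrank : ∀ i, schmidtRank (w i) ≤ k) :
    ∃ (J : ℕ) (K : Fin J → Matrix A (Fin k) ℂ) (U : Fin J → Matrix B β ℂ),
      (∀ j, (U j)ᴴ * U j = 1 ∧ U j * (U j)ᴴ = 1) ∧
      (∑ j, (K j)ᴴ * K j) = 1 ∧
      ∑ i, (p i : ℂ) • Matrix.vecMulVec (w i) (star (w i)) =
        ∑ j, (K j ⊗ₖ U j) * Matrix.vecMulVec (maxEntangled ι) (star (maxEntangled ι)) *
          (K j ⊗ₖ U j)ᴴ := by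
  choose K U hU hK hKU using fun i =>
    exists_kraus_of_schmidtRank_le hcard hk hι (w i) (hw i) (hrank i)
  have hsqrt : ∀ i, ((Real.sqrt (p i) : ℝ) : ℂ) * ((Real.sqrt (p i) : ℝ) : ℂ) = p i := fun i => by
    rw [← Complex.ofReal_mul, Real.mul_self_sqrt (hp i)]
  have hk0 : (k : ℂ) ≠ 0 := Nat.cast_ne_zero.mpr (NeZero.ne k)
  let E := (finProdFinEquiv (m := m) (n := k)).symm
  let K' : Fin m × Fin k → Matrix A (Fin k) ℂ := fun x =>
    ((Real.sqrt (p x.1) : ℝ) : ℂ) • K x.1 x.2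
  let U' : Fin m × Fin k → Matrix B β ℂ := fun x => U x.1 x.2
  refine ⟨m * k, fun j => K' (E j), fun j => U' (E j), fun j => hU _ _, ?_, ?_⟩
  · rw [E.sum_comp fun x => (K' x)ᴴ * K' x, Fintype.sum_prod_type]
    simp only [K', Matrix.conjTranspose_smul, Matrix.smul_mul, Matrix.mul_smul, smul_smul,
      Complex.star_def, Complex.conj_ofReal, hsqrt, ← Finset.smul_sum, hK]
    rw [← Finset.sum_smul, ← Complex.ofReal_sum, hsum, Complex.ofReal_one, one_smul]
  · rw [E.sum_comp fun x => (K' x ⊗ₖ U' x) *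
      Matrix.vecMulVec (maxEntangled ι) (star (maxEntangled ι)) * (K' x ⊗ₖ U' x)ᴴ,
      Fintype.sum_prod_type]
    refine Finset.sum_congr rfl fun i _ => ?_
    have hterm : ∀ s, (K' (i, s) ⊗ₖ U' (i, s)) *
        Matrix.vecMulVec (maxEntangled ι) (star (maxEntangled ι)) * (K' (i, s) ⊗ₖ U' (i, s))ᴴ =
        ((p i : ℂ) * (k : ℂ)⁻¹) • Matrix.vecMulVec (w i) (star (w i)) := by
      intro s
      rw [mul_vecMulVec_star_mul_conjTranspose, Matrix.smul_kronecker, Matrix.smul_mulVec,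
        hKU, smul_smul, vecMulVec_smul_star]
      congr 1
      rw [star_mul', Complex.star_def, Complex.conj_ofReal, Complex.conj_ofReal, mul_mul_mul_comm,
        hsqrt, inv_sqrt_mul_self]
    rw [Finset.sum_congr rfl fun s _ => hterm s, Finset.sum_const, Finset.card_univ,
      Fintype.card_fin, ← Nat.cast_smul_eq_nsmul ℂ, smul_smul, mul_left_comm,
      mul_inv_cancel₀ hk0, mul_one]

/-- **The Schmidt number is the maximal LOCC extension of the Schmidt rank.**
The infimum of the Schmidt rank over pure bipartite states that can be converted to `ρ`
by an LOCC channel (in the one-way Kraus form `σ ↦ ∑ⱼ (Kⱼ ⊗ Uⱼ) σ (Kⱼ ⊗ Uⱼ)†` with `Uⱼ`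
unitary, which suffices on pure inputs) equals the Terhal-Horodecki Schmidt number: the
least `k` such that `ρ` admits a pure-state decomposition into states of Schmidt
rank at most `k`. -/
theorem stmt18 (A B : Type) [Fintype A] [DecidableEq A] [Fintype B] [DecidableEq B]
    (ρ : Matrix (A × B) (A × B) ℂ) (hρ : IsDensity ρ) :
    sInf { k : ℕ | ∃ (a b : ℕ) (ψv : Fin a × Fin b → ℂ) (J : ℕ)
        (K : Fin J → Matrix A (Fin a) ℂ) (U : Fin J → Matrix B (Fin b) ℂ),
      -- ψ is a pure (unit) bipartite state
      star ψv ⬝ᵥ ψv = 1 ∧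
      -- the Uⱼ are unitary
      (∀ j, (U j)ᴴ * U j = 1 ∧ U j * (U j)ᴴ = 1) ∧
      -- the channel is trace preserving
      (∑ j, (K j)ᴴ * K j) = 1 ∧
      -- ρ is the image of ψ under the LOCC channel
      ρ = ∑ j, (K j ⊗ₖ U j) * Matrix.vecMulVec ψv (star ψv) * (K j ⊗ₖ U j)ᴴ ∧
      k = schmidtRank ψv } =
    sInf { k : ℕ | ∃ (m : ℕ) (p : Fin m → ℝ) (w : Fin m → (A × B → ℂ)),
      (∀ i, 0 ≤ p i) ∧ (∀ i, star (w i) ⬝ᵥ w i = 1) ∧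
      ρ = ∑ i, (p i : ℂ) • Matrix.vecMulVec (w i) (star (w i)) ∧
      ∀ i, schmidtRank (w i) ≤ k } := by
  apply Nat.sInf_eq_sInf_of_forall_exists_le
  · rintro _ ⟨a, b, ψ, J, K, U, -, -, -, hρψ, rfl⟩
    simp only [mul_vecMulVec_star_mul_conjTranspose] at hρψ
    obtain ⟨p, w, hp, hw, hdec, hrank⟩ := exists_decomposition_of_sum_vecMulVec
      (fun j => (K j ⊗ₖ U j) *ᵥ ψ) (fun j => schmidtRank_kronecker_mulVec_le _ _ ψ) (by
        by_contra! h
        have htr := hρ.2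
        rw [hρψ] at htr
        simp [h] at htr)
    exact ⟨_, ⟨J, p, w, hp, hw, hρψ.trans hdec, hrank⟩, le_rfl⟩
  · rintro k ⟨m, p, w, hp, hw, hdec, hrank⟩
    have hsum : ∑ i, p i = 1 := by
      have htr := hρ.2
      simp only [hdec, Matrix.trace_sum, Matrix.trace_smul, Matrix.trace_vecMulVec,
        dotProduct_comm _ (star _), hw, smul_eq_mul, mul_one] at htr
      exact_mod_cast htr
    have hrank' : ∀ i, schmidtRank (w i) ≤ min k (Fintype.card B) := fun i =>
      le_min (hrank i) (Matrix.rank_le_card_width _)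
    have hpos : NeZero (min k (Fintype.card B)) := by
      refine ⟨fun h0 => ?_⟩
      obtain ⟨i⟩ : Nonempty (Fin m) := by
        by_contra hm
        rw [not_nonempty_iff] at hm
        simp at hsum
      have hzero : Matrix.of (fun a b => w i (a, b)) = 0 :=
        Matrix.eq_zero_of_rank_eq_zero (Nat.le_zero.mp (h0 ▸ hrank' i))
      have hwi : w i = 0 := by
        ext ⟨a, b⟩
        exact congrFun (congrFun hzero a) b
      simpa [hwi] using hw i
    let ι : Fin (min k (Fintype.card B)) → Fin (Fintype.card B) := Fin.castLE (min_le_right _ _)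
    obtain ⟨J, K, U, hU, hK, hKU⟩ := exists_locc_of_decomposition (Fintype.card_fin _)
      (min_le_right _ _) (Fin.castLE_injective (min_le_right k (Fintype.card B))) p w hp hsum hw
      hrank'
    exact ⟨_, ⟨_, _, maxEntangled ι, J, K, U, star_maxEntangled_dotProduct ι, hU, hK,
      hdec.trans hKU, rfl⟩, (schmidtRank_maxEntangled_le ι).trans (min_le_left _ _)⟩
end
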